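/- For every x > 0 and every w ∈ (0,1): g(x,1) = ∫₀¹ g(wx, z) · g((1−w)x, 1−z) dz, and consequently g(x,1) = ∫₀¹ ∫₀¹ g(wx, z) · g((1−w)x, 1−z) dz dw. -/

import Mathlib

open MeasureTheory ProbabilityTheory Filter Set
open scoped ENNReal ProbabilityTheory Topology

/-- The standard normal density `φ(x) = (2π)^{-1/2} e^{-x²/2}`. -/
noncomputable def gaussφ (x : ℝ) : ℝ := (Real.sqrt (2 * Real.pi))⁻¹ * Real.exp (-x ^ 2 / 2)

/-- The density `φ⁺(x) = x e^{-x²/2}` for `x ≥ 0`, and `0` for `x < 0`. -/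
noncomputable def φplus (x : ℝ) : ℝ := if 0 ≤ x then x * Real.exp (-x ^ 2 / 2) else 0

/-- The random walk `S_n = X_1 + ⋯ + X_n`. -/
noncomputable def walkS {Ω : Type*} (X : ℕ → Ω → ℝ) (n : ℕ) (ω : Ω) : ℝ :=
  ∑ i ∈ Finset.range n, X (i + 1) ω

/-- The event `C_n = {S_1 > 0, …, S_n > 0}`. -/
def posEvent {Ω : Type*} (X : ℕ → Ω → ℝ) (n : ℕ) : Set Ω :=
  {ω | ∀ k, 1 ≤ k → k ≤ n → 0 < walkS X k ω}

/-- The density `g(a,t) = a/(√(2π) t^{3/2}) e^{-a²/(2t)}` of the first passage time `T_a`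
of a standard Brownian motion. -/
noncomputable def bmDensity (a t : ℝ) : ℝ :=
  a / (Real.sqrt (2 * Real.pi) * t ^ ((3 : ℝ) / 2)) * Real.exp (-a ^ 2 / (2 * t))

/-- If a nonnegative continuous derivative is defined on an open interval and its primitive has
limits at both endpoints, then the derivative integrates to the difference of these limits. -/
theorem integral_Ioo_of_hasDerivAt_of_nonneg_of_tendsto {f f' : ℝ → ℝ} {a b l m : ℝ}
    (hab : a < b) (hderiv : ∀ x ∈ Ioo a b, HasDerivAt f (f' x) x)
    (hnonneg : ∀ x ∈ Ioo a b, 0 ≤ f' x)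
    (ha : Tendsto f (𝓝[>] a) (𝓝 l)) (hb : Tendsto f (𝓝[<] b) (𝓝 m)) :
    ∫ x in Ioo a b, f' x = m - l := by
  have hcont : ContinuousOn (extendFrom (Ioo a b) f) (Icc a b) :=
    continuousOn_Icc_extendFrom_Ioo
      (fun x hx => (hderiv x hx).continuousAt.continuousWithinAt) ha hb
  have hderiv' : ∀ x ∈ Ioo a b, HasDerivAt (extendFrom (Ioo a b) f) (f' x) x := by
    intro x hx
    refine (hderiv x hx).congr_of_eventuallyEq ?_
    filter_upwards [Ioo_mem_nhds hx.1 hx.2] with y hy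
    exact extendFrom_eq (subset_closure hy) (hderiv y hy).continuousAt.continuousWithinAt
  have hint : IntervalIntegrable f' volume a b :=
    (intervalIntegrable_iff_integrableOn_Ioc_of_le hab.le).2
      (intervalIntegral.integrableOn_deriv_of_nonneg hcont hderiv' hnonneg)
  rw [← integral_Ioc_eq_integral_Ioo, ← intervalIntegral.integral_of_le hab.le]
  exact intervalIntegral.integral_eq_sub_of_hasDerivAt_of_tendsto hab hderiv hint ha hb

/-- The primitive of `e^{-y²/2}` vanishing at `0`. -/
noncomputable def gaussPrimitive (v : ℝ) : ℝ := ∫ y in (0 : ℝ)..v, Real.exp (-y ^ 2 / 2)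

theorem hasDerivAt_gaussPrimitive (v : ℝ) :
    HasDerivAt gaussPrimitive (Real.exp (-v ^ 2 / 2)) v := by
  have hc : Continuous fun y : ℝ => Real.exp (-y ^ 2 / 2) := by fun_prop
  exact hc.integral_hasStrictDerivAt 0 v |>.hasDerivAt

theorem gaussPrimitive_neg (v : ℝ) : gaussPrimitive (-v) = -gaussPrimitive v := by
  have h := intervalIntegral.integral_comp_neg (a := 0) (b := v)
    (fun y : ℝ => Real.exp (-y ^ 2 / 2))
  simp only [neg_sq, neg_zero] at h
  rw [gaussPrimitive, gaussPrimitive, h, intervalIntegral.integral_symm]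

theorem tendsto_gaussPrimitive_atTop :
    Tendsto gaussPrimitive atTop (𝓝 (Real.sqrt (2 * Real.pi) / 2)) := by
  have hfun : (fun y : ℝ => Real.exp (-y ^ 2 / 2)) = fun y => Real.exp (-(1 / 2) * y ^ 2) := by
    ext y
    ring_nf
  have hint : Integrable fun y : ℝ => Real.exp (-y ^ 2 / 2) := by
    rw [hfun]
    exact integrable_exp_neg_mul_sq (by norm_num)
  have hval : ∫ y in Ioi (0 : ℝ), Real.exp (-y ^ 2 / 2) = Real.sqrt (2 * Real.pi) / 2 := by
    rw [hfun, integral_gaussian_Ioi]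
    congr 2
    ring
  rw [← hval]
  exact intervalIntegral_tendsto_integral_Ioi 0 hint.integrableOn tendsto_id

theorem tendsto_gaussPrimitive_atBot :
    Tendsto gaussPrimitive atBot (𝓝 (-(Real.sqrt (2 * Real.pi) / 2))) := by
  refine (tendsto_gaussPrimitive_atTop.comp tendsto_neg_atBot_atTop).neg.congr fun v => ?_
  simp [gaussPrimitive_neg]

/-- The position `(bz + c(1-z)) / √(z(1-z))`, the argument of the Gaussian primitives in the
antiderivative of the convolution integrand. -/
noncomputable def bridgeArg (b c z : ℝ) : ℝ := (b * z + c * (1 - z)) / Real.sqrt (z * (1 - z))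

theorem hasDerivAt_bridgeArg (b c : ℝ) {z : ℝ} (hz : z ∈ Ioo (0 : ℝ) 1) :
    HasDerivAt (bridgeArg b c)
      ((b * z - c * (1 - z)) / (2 * (z * (1 - z) * Real.sqrt (z * (1 - z))))) z := by
  have hr : 0 < z * (1 - z) := mul_pos hz.1 (sub_pos.2 hz.2)
  have hs : 0 < Real.sqrt (z * (1 - z)) := Real.sqrt_pos.2 hr
  have hsub : HasDerivAt (fun y : ℝ => 1 - y) (-1) z := by
    simpa using (hasDerivAt_id z).const_sub 1
  have hnum := ((hasDerivAt_id z).const_mul b).add (hsub.const_mul c)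
  have hden := ((hasDerivAt_id z).mul hsub).sqrt hr.ne'
  refine (hnum.div hden hs.ne').congr_deriv ?_
  simp only [id, Pi.mul_apply, Pi.add_apply]
  have hsq := Real.sq_sqrt hr.le
  set s := Real.sqrt (z * (1 - z))
  rw [← hsq]
  field_simp
  rw [hsq]
  ring

theorem exp_neg_bridgeArg_sq (b c : ℝ) {z : ℝ} (hz : z ∈ Ioo (0 : ℝ) 1) :
    Real.exp (-(b - c) ^ 2 / 2) * Real.exp (-(bridgeArg b c z) ^ 2 / 2) =
      Real.exp (-c ^ 2 / (2 * z)) * Real.exp (-b ^ 2 / (2 * (1 - z))) := by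
  have h0 : z ≠ 0 := hz.1.ne'
  have h1 : 1 - z ≠ 0 := (sub_pos.2 hz.2).ne'
  rw [← Real.exp_add, ← Real.exp_add, bridgeArg, div_pow,
    Real.sq_sqrt (mul_pos hz.1 (sub_pos.2 hz.2)).le]
  congr 1
  field_simp
  ring

theorem tendsto_inv_sqrt_mul_one_sub_zero :
    Tendsto (fun z : ℝ => (Real.sqrt (z * (1 - z)))⁻¹) (𝓝[>] 0) atTop := by
  refine Tendsto.inv_tendsto_nhdsGT_zero (tendsto_nhdsWithin_iff.2 ⟨?_, ?_⟩)
  · have h : Continuous fun z : ℝ => Real.sqrt (z * (1 - z)) := by fun_prop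
    simpa using (h.tendsto 0).mono_left nhdsWithin_le_nhds
  · filter_upwards [Ioo_mem_nhdsGT (zero_lt_one' ℝ)] with z hz
    exact Real.sqrt_pos.2 (mul_pos hz.1 (sub_pos.2 hz.2))

theorem tendsto_inv_sqrt_mul_one_sub_one :
    Tendsto (fun z : ℝ => (Real.sqrt (z * (1 - z)))⁻¹) (𝓝[<] 1) atTop := by
  refine Tendsto.inv_tendsto_nhdsGT_zero (tendsto_nhdsWithin_iff.2 ⟨?_, ?_⟩)
  · have h : Continuous fun z : ℝ => Real.sqrt (z * (1 - z)) := by fun_prop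
    simpa using (h.tendsto 1).mono_left nhdsWithin_le_nhds
  · filter_upwards [Ioo_mem_nhdsLT (zero_lt_one' ℝ)] with z hz
    exact Real.sqrt_pos.2 (mul_pos hz.1 (sub_pos.2 hz.2))

theorem tendsto_bridgeArg_zero_atTop (b : ℝ) {c : ℝ} (hc : 0 < c) :
    Tendsto (bridgeArg b c) (𝓝[>] 0) atTop := by
  have h : Continuous fun z : ℝ => b * z + c * (1 - z) := by fun_prop
  have h0 : Tendsto (fun z : ℝ => b * z + c * (1 - z)) (𝓝[>] 0) (𝓝 c) := by
    simpa using (h.tendsto 0).mono_left nhdsWithin_le_nhds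
  exact h0.pos_mul_atTop hc tendsto_inv_sqrt_mul_one_sub_zero

theorem tendsto_bridgeArg_zero_atBot (b : ℝ) {c : ℝ} (hc : c < 0) :
    Tendsto (bridgeArg b c) (𝓝[>] 0) atBot := by
  have h : Continuous fun z : ℝ => b * z + c * (1 - z) := by fun_prop
  have h0 : Tendsto (fun z : ℝ => b * z + c * (1 - z)) (𝓝[>] 0) (𝓝 c) := by
    simpa using (h.tendsto 0).mono_left nhdsWithin_le_nhds
  exact h0.neg_mul_atTop hc tendsto_inv_sqrt_mul_one_sub_zero

theorem tendsto_bridgeArg_one_atTop {b : ℝ} (c : ℝ) (hb : 0 < b) :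
    Tendsto (bridgeArg b c) (𝓝[<] 1) atTop := by
  have h : Continuous fun z : ℝ => b * z + c * (1 - z) := by fun_prop
  have h1 : Tendsto (fun z : ℝ => b * z + c * (1 - z)) (𝓝[<] 1) (𝓝 b) := by
    simpa using (h.tendsto 1).mono_left nhdsWithin_le_nhds
  exact h1.pos_mul_atTop hb tendsto_inv_sqrt_mul_one_sub_one

theorem rpow_three_halves {t : ℝ} (ht : 0 < t) : t ^ ((3 : ℝ) / 2) = t * Real.sqrt t := by
  rw [Real.sqrt_eq_rpow, show (3 : ℝ) / 2 = 1 + 1 / 2 by norm_num, Real.rpow_add ht, Real.rpow_one]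

theorem bmDensity_nonneg {a t : ℝ} (ha : 0 ≤ a) (ht : 0 ≤ t) : 0 ≤ bmDensity a t := by
  unfold bmDensity
  positivity

theorem bmDensity_mul_bmDensity (a b : ℝ) {z : ℝ} (hz : z ∈ Ioo (0 : ℝ) 1) :
    bmDensity a z * bmDensity b (1 - z) =
      a * b / (2 * Real.pi * (z * (1 - z) * Real.sqrt (z * (1 - z)))) *
        (Real.exp (-a ^ 2 / (2 * z)) * Real.exp (-b ^ 2 / (2 * (1 - z)))) := by
  have hz1 : 0 < 1 - z := sub_pos.2 hz.2
  have hpi : Real.sqrt (2 * Real.pi) * Real.sqrt (2 * Real.pi) = 2 * Real.pi :=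
    Real.mul_self_sqrt (by positivity)
  rw [bmDensity, bmDensity, rpow_three_halves hz.1, rpow_three_halves hz1,
    Real.sqrt_mul hz.1.le, mul_mul_mul_comm, div_mul_div_comm,
    mul_mul_mul_comm (Real.sqrt (2 * Real.pi)), hpi]
  congr 2
  ring

/-- An antiderivative of `z ↦ g(a,z) g(b,1-z)` on `(0,1)`. -/
noncomputable def bmConvPrimitive (a b z : ℝ) : ℝ :=
  (2 * Real.pi)⁻¹ *
    ((a + b) * (Real.exp (-(b - -a) ^ 2 / 2) * gaussPrimitive (bridgeArg b (-a) z)) +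
      (a - b) * (Real.exp (-(b - a) ^ 2 / 2) * gaussPrimitive (bridgeArg b a z)))

theorem hasDerivAt_bmConvPrimitive (a b : ℝ) {z : ℝ} (hz : z ∈ Ioo (0 : ℝ) 1) :
    HasDerivAt (bmConvPrimitive a b) (bmDensity a z * bmDensity b (1 - z)) z := by
  have hd (c : ℝ) : HasDerivAt
      (fun y => Real.exp (-(b - c) ^ 2 / 2) * gaussPrimitive (bridgeArg b c y))
      (Real.exp (-c ^ 2 / (2 * z)) * Real.exp (-b ^ 2 / (2 * (1 - z))) *
        ((b * z - c * (1 - z)) / (2 * (z * (1 - z) * Real.sqrt (z * (1 - z)))))) z := by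
    rw [← exp_neg_bridgeArg_sq b c hz, mul_assoc]
    exact ((hasDerivAt_gaussPrimitive _).comp z (hasDerivAt_bridgeArg b c hz)).const_mul _
  refine ((((hd (-a)).const_mul (a + b)).add ((hd a).const_mul (a - b))).const_mul
    (2 * Real.pi)⁻¹).congr_deriv ?_
  rw [bmDensity_mul_bmDensity a b hz, neg_sq]
  have hr : 0 < z * (1 - z) := mul_pos hz.1 (sub_pos.2 hz.2)
  have hs : 0 < Real.sqrt (z * (1 - z)) := Real.sqrt_pos.2 hr
  have hq : z * (1 - z) * Real.sqrt (z * (1 - z)) ≠ 0 := (mul_pos hr hs).ne'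
  set q := z * (1 - z) * Real.sqrt (z * (1 - z))
  field_simp
  ring

/-- The convolution identity `∫₀¹ g(a,z) g(b,1-z) dz = g(a+b,1)`. -/
theorem integral_bmDensity_mul_bmDensity {a b : ℝ} (ha : 0 < a) (hb : 0 < b) :
    ∫ z in Ioo (0 : ℝ) 1, bmDensity a z * bmDensity b (1 - z) = bmDensity (a + b) 1 := by
  have hlim {l : Filter ℝ} {p q : ℝ}
      (hp : Tendsto (fun z => gaussPrimitive (bridgeArg b (-a) z)) l (𝓝 p))
      (hq : Tendsto (fun z => gaussPrimitive (bridgeArg b a z)) l (𝓝 q)) :=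
    (((hp.const_mul (Real.exp (-(b - -a) ^ 2 / 2))).const_mul (a + b)).add
      ((hq.const_mul (Real.exp (-(b - a) ^ 2 / 2))).const_mul (a - b))).const_mul
        (2 * Real.pi)⁻¹
  have h0 := hlim
    (tendsto_gaussPrimitive_atBot.comp (tendsto_bridgeArg_zero_atBot b (neg_neg_of_pos ha)))
    (tendsto_gaussPrimitive_atTop.comp (tendsto_bridgeArg_zero_atTop b ha))
  have h1 := hlim
    (tendsto_gaussPrimitive_atTop.comp (tendsto_bridgeArg_one_atTop (-a) hb))
    (tendsto_gaussPrimitive_atTop.comp (tendsto_bridgeArg_one_atTop a hb))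
  rw [integral_Ioo_of_hasDerivAt_of_nonneg_of_tendsto (f := bmConvPrimitive a b) one_pos
    (fun z hz => hasDerivAt_bmConvPrimitive a b hz)
    (fun z hz => mul_nonneg (bmDensity_nonneg ha.le hz.1.le)
      (bmDensity_nonneg hb.le (sub_nonneg.2 hz.2.le))) h0 h1]
  have hpi : 2 * Real.pi = Real.sqrt (2 * Real.pi) ^ 2 := (Real.sq_sqrt (by positivity)).symm
  have hs : Real.sqrt (2 * Real.pi) ≠ 0 := (Real.sqrt_pos.2 (by positivity)).ne'
  rw [bmDensity, Real.one_rpow, sub_neg_eq_add, add_comm b a, mul_one, mul_one]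
  set s := Real.sqrt (2 * Real.pi)
  rw [hpi]
  field_simp
  ring

/-- Appendix B, equation (20): for every `x > 0` and `w ∈ (0,1)`,
`g(x,1) = ∫₀¹ g(wx,z) g((1−w)x, 1−z) dz`, and consequently
`g(x,1) = ∫₀¹∫₀¹ g(wx,z) g((1−w)x, 1−z) dz dw`. -/
theorem first_passage_convolution (x : ℝ) (hx : 0 < x) :
    (∀ w ∈ Set.Ioo (0 : ℝ) 1,
      bmDensity x 1 =
        ∫ z in Set.Ioo (0 : ℝ) 1, bmDensity (w * x) z * bmDensity ((1 - w) * x) (1 - z)) ∧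
    bmDensity x 1 =
      ∫ w in Set.Ioo (0 : ℝ) 1, ∫ z in Set.Ioo (0 : ℝ) 1,
        bmDensity (w * x) z * bmDensity ((1 - w) * x) (1 - z) := by
  have hconv : ∀ w ∈ Ioo (0 : ℝ) 1,
      bmDensity x 1 =
        ∫ z in Ioo (0 : ℝ) 1, bmDensity (w * x) z * bmDensity ((1 - w) * x) (1 - z) := by
    intro w hw
    rw [integral_bmDensity_mul_bmDensity (mul_pos hw.1 hx) (mul_pos (sub_pos.2 hw.2) hx)]
    congr 1
    ring
  refine ⟨hconv, ?_⟩
  rw [← setIntegral_congr_fun measurableSet_Ioo hconv]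
  simp
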